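/- arXiv:2510.25104 — 2 statements merged into one kernel-verified Lean document; each statement's English description precedes it below -/
import Mathlib

section
/- For every nonnegative integer n, F_2(n) - F_3(n) = (-1)^n · p̄_o(n), where F_2(n) (resp. F_3(n)) counts the partitions counted by F(n) with an even (resp. odd) total number of parts, and p̄_o(n) is the number of overpartitions of n into odd parts. -/
noncomputable section

/-- Overpartitions of `n`: the first component is the set of overlined parts
(at most one overlined part of each size), the second is the multiset of
non-overlined parts; all parts are positive and the total sum is `n`. -/
def overpartitions (n : ℕ) : Set (Finset ℕ × Multiset ℕ) :=
  {p | (∀ x ∈ p.1, 0 < x) ∧ (∀ x ∈ p.2, 0 < x) ∧ p.1.sum id + p.2.sum = n}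

/-- `p̄(n)`, the number of overpartitions of `n`. -/
def pbar (n : ℕ) : ℕ := (overpartitions n).ncard

/-- Overpartitions of `n` into odd parts. -/
def overpartitionsOdd (n : ℕ) : Set (Finset ℕ × Multiset ℕ) :=
  {p | p ∈ overpartitions n ∧ (∀ x ∈ p.1, Odd x) ∧ ∀ x ∈ p.2, Odd x}

/-- `p̄_o(n)`, the number of overpartitions of `n` into odd parts. -/
def pbarOdd (n : ℕ) : ℕ := (overpartitionsOdd n).ncard

/-- Two-color partitions of `n` (first component: blue parts, second: green
parts) in which even parts may occur only in the blue color, i.e. all green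
parts are odd. -/
def FSet (n : ℕ) : Set (Multiset ℕ × Multiset ℕ) :=
  {p | (∀ x ∈ p.1, 0 < x) ∧ (∀ x ∈ p.2, 0 < x) ∧ p.1.sum + p.2.sum = n ∧
    ∀ x ∈ p.2, Odd x}

/-- `F(n)`. -/
def Fcount (n : ℕ) : ℕ := (FSet n).ncard

/-- The number of even parts of a multiset of naturals. -/
def evenParts (m : Multiset ℕ) : ℕ := Multiset.card (m.filter (fun x => Even x))

/-- `F₀(n)`: partitions counted by `F(n)` with an even number of even parts. -/
def F0 (n : ℕ) : ℕ := {p ∈ FSet n | Even (evenParts (p.1 + p.2))}.ncard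

/-- `F₁(n)`: partitions counted by `F(n)` with an odd number of even parts. -/
def F1 (n : ℕ) : ℕ := {p ∈ FSet n | Odd (evenParts (p.1 + p.2))}.ncard

/-- `F₂(n)`: partitions counted by `F(n)` with an even number of parts. -/
def F2 (n : ℕ) : ℕ := {p ∈ FSet n | Even (Multiset.card (p.1 + p.2))}.ncard

/-- `F₃(n)`: partitions counted by `F(n)` with an odd number of parts. -/
def F3 (n : ℕ) : ℕ := {p ∈ FSet n | Odd (Multiset.card (p.1 + p.2))}.ncard

/-- Partitions counted by `F(n)` whose blue parts are distinct odd numbers. -/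
def QSet (n : ℕ) : Set (Multiset ℕ × Multiset ℕ) :=
  {p | p ∈ FSet n ∧ (∀ x ∈ p.1, Odd x) ∧ p.1.Nodup}

/-- `Q(n)`. -/
def Qcount (n : ℕ) : ℕ := (QSet n).ncard

/-- Two-color partitions of `n` (first component: blue parts, second: green
parts) in which odd parts may occur only in the blue color, i.e. all green
parts are even. -/
def GSet (n : ℕ) : Set (Multiset ℕ × Multiset ℕ) :=
  {p | (∀ x ∈ p.1, 0 < x) ∧ (∀ x ∈ p.2, 0 < x) ∧ p.1.sum + p.2.sum = n ∧
    ∀ x ∈ p.2, Even x}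

/-- `G(n)`. -/
def Gcount (n : ℕ) : ℕ := (GSet n).ncard

/-- `G₀(n)`: partitions counted by `G(n)` with an even number of blue even parts. -/
def G0 (n : ℕ) : ℕ := {p ∈ GSet n | Even (evenParts p.1)}.ncard

/-- `G₁(n)`: partitions counted by `G(n)` with an odd number of blue even parts. -/
def G1 (n : ℕ) : ℕ := {p ∈ GSet n | Odd (evenParts p.1)}.ncard

/-- `G₂(n)`: partitions counted by `G(n)` with an even number of blue parts. -/
def G2 (n : ℕ) : ℕ := {p ∈ GSet n | Even (Multiset.card p.1)}.ncard

/-- `G₃(n)`: partitions counted by `G(n)` with an odd number of blue parts. -/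
def G3 (n : ℕ) : ℕ := {p ∈ GSet n | Odd (Multiset.card p.1)}.ncard

/-- `G₄(n)`: partitions counted by `G(n)` with an even total number of parts. -/
def G4 (n : ℕ) : ℕ := {p ∈ GSet n | Even (Multiset.card (p.1 + p.2))}.ncard

/-- `G₅(n)`: partitions counted by `G(n)` with an odd total number of parts. -/
def G5 (n : ℕ) : ℕ := {p ∈ GSet n | Odd (Multiset.card (p.1 + p.2))}.ncard

/-- Partitions of `n` in which the odd parts are distinct. -/
def HSet (n : ℕ) : Set (Multiset ℕ) :=
  {m | (∀ x ∈ m, 0 < x) ∧ m.sum = n ∧ (m.filter (fun x => Odd x)).Nodup}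

/-- `H(n)`. -/
def Hcount (n : ℕ) : ℕ := (HSet n).ncard

/-- Partitions of `n` into distinct parts whose even parts are all
congruent to `2` modulo `4`. -/
def KSet (n : ℕ) : Set (Finset ℕ) :=
  {s | (∀ x ∈ s, 0 < x) ∧ s.sum id = n ∧ ∀ x ∈ s, Even x → x % 4 = 2}

/-- `K(n)`: the signed count of partitions in `KSet n`, each weighted by
`(-1)^j` where `j` is the number of even parts. -/
def Kcount (n : ℕ) : ℤ :=
  ({s ∈ KSet n | Even (s.filter (fun x => Even x)).card}.ncard : ℤ) -
  ({s ∈ KSet n | Odd (s.filter (fun x => Even x)).card}.ncard : ℤ)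

/-- Partitions counted by `G(n)` whose blue parts are distinct odd numbers. -/
def RSet (n : ℕ) : Set (Multiset ℕ × Multiset ℕ) :=
  {p | p ∈ GSet n ∧ (∀ x ∈ p.1, Odd x) ∧ p.1.Nodup}

/-- `R(n)`. -/
def Rcount (n : ℕ) : ℕ := (RSet n).ncard

/-- Two-color partitions of `n` in which all parts of the same color are
distinct and odd parts may occur only in the blue color: the first component
is the (finite) set of blue parts (distinct positive integers), the second the
set of green parts (distinct positive even integers). -/
def LSet (n : ℕ) : Set (Finset ℕ × Finset ℕ) :=
  {p | (∀ x ∈ p.1, 0 < x) ∧ (∀ x ∈ p.2, 0 < x ∧ Even x) ∧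
    p.1.sum id + p.2.sum id = n}

/-- `L₀(n)`: partitions counted by `L(n)` with an even number of blue even parts. -/
def L0 (n : ℕ) : ℕ := {p ∈ LSet n | Even (p.1.filter (fun x => Even x)).card}.ncard

/-- `L₁(n)`: partitions counted by `L(n)` with an odd number of blue even parts. -/
def L1 (n : ℕ) : ℕ := {p ∈ LSet n | Odd (p.1.filter (fun x => Even x)).card}.ncard

/-- `L₂(n)`: partitions counted by `L(n)` with an even number of blue parts. -/
def L2 (n : ℕ) : ℕ := {p ∈ LSet n | Even p.1.card}.ncard

/-- `L₃(n)`: partitions counted by `L(n)` with an odd number of blue parts. -/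
def L3 (n : ℕ) : ℕ := {p ∈ LSet n | Odd p.1.card}.ncard

def candP (b : Multiset ℕ) (y : ℕ) : Prop := 1 ≤ b.count (2*y) ∨ 2 ≤ b.count y

def isX (b : Multiset ℕ) (x : ℕ) : Prop := candP b x ∧ ∀ y, candP b y → y ≤ x

def stepF (b : Multiset ℕ) (x : ℕ) : Multiset ℕ :=
  if 1 ≤ b.count (2*x) then x ::ₘ x ::ₘ b.erase (2*x) else (2*x) ::ₘ (b.erase x).erase x

lemma count_erase_aux (b : Multiset ℕ) (x z : ℕ) :
    (b.erase x).count z = if z = x then b.count z - 1 else b.count z := by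
  split_ifs with h
  · subst h; exact Multiset.count_erase_self _ _
  · exact Multiset.count_erase_of_ne h _

lemma count_stepF (b : Multiset ℕ) (x z : ℕ) (hx : 0 < x) :
    (stepF b x).count z = if 1 ≤ b.count (2*x) then
      (if z = x then b.count z + 2 else if z = 2*x then b.count z - 1 else b.count z)
      else (if z = x then b.count z - 2 else if z = 2*x then b.count z + 1 else b.count z) := by
  unfold stepF
  split_ifs <;> simp only [Multiset.count_cons, count_erase_aux] <;> grind

lemma isX_stepF {b : Multiset ℕ} {x : ℕ} (hx : 0 < x) (h : isX b x) : isX (stepF b x) x := by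
  obtain ⟨h1, h2⟩ := h
  have h3 := h2 (2*x)
  unfold candP at *
  refine ⟨?_, fun y hy => ?_⟩
  · unfold candP
    rw [count_stepF _ _ _ hx, count_stepF _ _ _ hx]
    grind
  · unfold candP at hy
    rw [count_stepF _ _ _ hx, count_stepF _ _ _ hx] at hy
    have := h2 y
    grind

lemma stepF_stepF {b : Multiset ℕ} {x : ℕ} (hx : 0 < x) (h : isX b x) :
    stepF (stepF b x) x = b := by
  obtain ⟨h1, h2⟩ := h
  have h3 := h2 (2*x)
  unfold candP at *
  ext z
  rw [count_stepF _ _ _ hx, count_stepF _ _ _ hx, count_stepF _ _ _ hx]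
  grind

lemma isX_unique {b : Multiset ℕ} {x y : ℕ} (h : isX b x) (h' : isX b y) : x = y :=
  le_antisymm (h'.2 _ h.1) (h.2 _ h'.1)

lemma exists_isX {b : Multiset ℕ} {y : ℕ} (h : candP b y) : ∃ x, isX b x := by
  classical
  have hb : ∀ z, candP b z → z ≤ b.sum := by
    intro z hz
    rcases hz with hz | hz
    · have := Multiset.le_sum_of_mem (Multiset.one_le_count_iff_mem.1 hz)
      omega
    · exact Multiset.le_sum_of_mem (Multiset.one_le_count_iff_mem.1 (by omega))
  refine ⟨Nat.findGreatest (candP b) b.sum, Nat.findGreatest_spec (hb _ h) h, fun z hz => ?_⟩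
  exact Nat.le_findGreatest (hb z hz) hz

open Classical in
def invF (b : Multiset ℕ) : Multiset ℕ := if h : ∃ x, isX b x then stepF b h.choose else b

lemma invF_eq {b : Multiset ℕ} {x : ℕ} (h : isX b x) : invF b = stepF b x := by
  have h' : ∃ x, isX b x := ⟨x, h⟩
  rw [invF, dif_pos h', isX_unique h'.choose_spec h]

lemma isX_pos {b : Multiset ℕ} {x : ℕ} (hb : ∀ x ∈ b, 0 < x) (h : isX b x) : 0 < x := by
  rcases h.1 with h | h
  · have := hb _ (Multiset.one_le_count_iff_mem.1 h); omega
  · exact hb _ (Multiset.one_le_count_iff_mem.1 (by omega))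

lemma pos_stepF {b : Multiset ℕ} {x : ℕ} (hx : 0 < x) (hb : ∀ x ∈ b, 0 < x) :
    ∀ y ∈ stepF b x, 0 < y := by
  intro y hy
  by_contra h0
  have h0 : y = 0 := by omega
  subst h0
  have : b.count 0 = 0 := Multiset.count_eq_zero.2 fun h => absurd (hb _ h) (by simp)
  have h2 := Multiset.one_le_count_iff_mem.2 hy
  rw [count_stepF _ _ _ hx] at h2
  grind

lemma stepF_decomp {b : Multiset ℕ} {x : ℕ} (h : isX b x) :
    ∃ c, (b = (2*x) ::ₘ c ∧ stepF b x = x ::ₘ x ::ₘ c) ∨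
      (b = x ::ₘ x ::ₘ c ∧ stepF b x = (2*x) ::ₘ c) := by
  unfold stepF
  split_ifs with h1
  · exact ⟨b.erase (2*x), Or.inl
      ⟨(Multiset.cons_erase (Multiset.one_le_count_iff_mem.1 h1)).symm, rfl⟩⟩
  · refine ⟨(b.erase x).erase x, Or.inr ⟨?_, rfl⟩⟩
    have h2 : 2 ≤ b.count x := by rcases h.1 with h | h <;> [exact absurd h h1; exact h]
    rw [Multiset.cons_erase, Multiset.cons_erase]
    · exact Multiset.one_le_count_iff_mem.1 (by omega)
    · apply Multiset.one_le_count_iff_mem.1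
      rw [Multiset.count_erase_self]; omega

lemma sum_stepF {b : Multiset ℕ} {x : ℕ} (h : isX b x) : (stepF b x).sum = b.sum := by
  obtain ⟨c, ⟨h1, h2⟩ | ⟨h1, h2⟩⟩ := stepF_decomp h <;> rw [h2, h1] <;> simp <;> ring

lemma sign_stepF {b : Multiset ℕ} {x : ℕ} (h : isX b x) :
    (-1 : ℤ) ^ (stepF b x).card = - (-1) ^ b.card := by
  obtain ⟨c, ⟨h1, h2⟩ | ⟨h1, h2⟩⟩ := stepF_decomp h <;> rw [h2, h1] <;> simp [pow_succ]

lemma odd_card (m : Multiset ℕ) (h : ∀ x ∈ m, Odd x) : (-1 : ℤ) ^ m.card = (-1) ^ m.sum := by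
  induction m using Multiset.induction_on with
  | empty => simp
  | cons a m ih =>
    have := ih fun x hx => h x (Multiset.mem_cons_of_mem hx)
    have ha : (-1 : ℤ) ^ a = -1 := (h a (Multiset.mem_cons_self a m)).neg_one_pow
    simp [pow_succ, pow_add, this, ha]

lemma card_le_sum' (m : Multiset ℕ) (h : ∀ x ∈ m, 0 < x) : m.card ≤ m.sum := by
  induction m using Multiset.induction_on with
  | empty => simp
  | cons a m ih =>
    have := ih fun x hx => h x (Multiset.mem_cons_of_mem hx)
    have ha := h a (Multiset.mem_cons_self a m)
    simp; omega

lemma bounded_mem (n : ℕ) (m : Multiset ℕ) (h : ∀ x ∈ m, 0 < x) (hs : m.sum ≤ n) :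
    m ∈ Set.Iic (n • Multiset.range (n+1)) := by
  rw [Set.mem_Iic, Multiset.le_iff_count]
  intro a
  by_cases ha : a ∈ m
  · have h1 := Multiset.le_sum_of_mem ha
    have h2 := card_le_sum' m h
    have h3 := Multiset.count_le_card a m
    have h4 : 1 ≤ (Multiset.range (n+1)).count a :=
      Multiset.one_le_count_iff_mem.2 (Multiset.mem_range.2 (by omega))
    rw [Multiset.count_nsmul]
    nlinarith
  · simp [Multiset.count_eq_zero.2 ha]

lemma FSet_finite (n : ℕ) : (FSet n).Finite := by
  refine ((Set.finite_Iic (n • Multiset.range (n+1))).prod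
    (Set.finite_Iic (n • Multiset.range (n+1)))).subset ?_
  rintro ⟨b, g⟩ ⟨h1, h2, h3, -⟩
  simp only at h1 h2 h3
  exact ⟨bounded_mem n b h1 (by omega), bounded_mem n g h2 (by omega)⟩

lemma no_isX {b : Multiset ℕ} (h : ¬ ∃ x, isX b x) : (∀ x ∈ b, Odd x) ∧ b.Nodup := by
  have h' : ∀ y, ¬ candP b y := fun y hy => h (exists_isX hy)
  constructor
  · intro x hx
    by_contra ho
    obtain ⟨y, rfl⟩ := (Nat.not_odd_iff_even.1 ho).two_dvd
    exact h' y (Or.inl (Multiset.one_le_count_iff_mem.2 hx))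
  · rw [Multiset.nodup_iff_count_le_one]
    intro a
    by_contra ha
    exact h' a (Or.inr (by omega))

lemma no_isX' {b : Multiset ℕ} (h1 : ∀ x ∈ b, Odd x) (h2 : b.Nodup) : ¬ ∃ x, isX b x := by
  rintro ⟨x, hx, -⟩
  rcases hx with hx | hx
  · have := h1 _ (Multiset.one_le_count_iff_mem.1 hx)
    grind
  · have := Multiset.nodup_iff_count_le_one.1 h2 x
    omega

lemma QSet_ncard (n : ℕ) : (QSet n).ncard = pbarOdd n := by
  unfold pbarOdd
  symm
  refine Set.ncard_congr (fun p _ => (p.1.val, p.2)) ?_ ?_ ?_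
  · rintro ⟨s, m⟩ ⟨⟨h1, h2, h3⟩, h4, h5⟩
    refine ⟨⟨h1, h2, ?_, h5⟩, h4, s.nodup⟩
    have e : s.sum id = s.val.sum := by rw [Finset.sum, Multiset.map_id]
    exact e ▸ h3
  · rintro ⟨s, m⟩ ⟨s', m'⟩ _ _ h
    simpa using h
  · rintro ⟨b, g⟩ ⟨⟨h1, h2, h3, h4⟩, h5, h6⟩
    refine ⟨(⟨b, h6⟩, g), ⟨⟨h1, h2, ?_⟩, h5, h4⟩, rfl⟩
    simpa [Finset.sum] using h3

/-- `F₂(n) - F₃(n) = (-1)^n * p̄_o(n)`. -/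
theorem F2_sub_F3 (n : ℕ) : (F2 n : ℤ) - (F3 n : ℤ) = (-1) ^ n * (pbarOdd n : ℤ) := by
  classical
  set T := (FSet_finite n).toFinset with hT
  have hm : ∀ p, p ∈ T ↔ p ∈ FSet n := fun p => by simp [hT]
  have e2 : F2 n = (T.filter fun p => Even (Multiset.card (p.1 + p.2))).card := by
    rw [F2, ← Set.ncard_coe_finset]; congr 1; ext p; simp [hm]
  have e3 : F3 n = (T.filter fun p => ¬ Even (Multiset.card (p.1 + p.2))).card := by
    rw [F3, ← Set.ncard_coe_finset]; congr 1; ext p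
    simp only [Finset.coe_filter, hm, Nat.not_even_iff_odd]
  have eQ : pbarOdd n = (T.filter fun p => ¬ ∃ x, isX p.1 x).card := by
    rw [← QSet_ncard, ← Set.ncard_coe_finset]; congr 1; ext p
    simp only [Finset.coe_filter, hm]
    exact ⟨fun h => ⟨h.1, no_isX' h.2.1 h.2.2⟩, fun h => ⟨h.1, no_isX h.2⟩⟩
  have hs : (F2 n : ℤ) - F3 n = ∑ p ∈ T, (-1 : ℤ) ^ (Multiset.card (p.1 + p.2)) := by
    rw [← Finset.sum_filter_add_sum_filter_not T fun p => Even (Multiset.card (p.1 + p.2)),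
      Finset.sum_congr rfl (g := fun _ => (1:ℤ)), 
      Finset.sum_congr (s₁ := T.filter fun p => ¬ Even (Multiset.card (p.1 + p.2)))
        rfl (g := fun _ => (-1:ℤ)), e2, e3]
    · simp; ring
    · intro p hp
      exact (Nat.not_even_iff_odd.1 (Finset.mem_filter.1 hp).2).neg_one_pow
    · intro p hp
      exact (Finset.mem_filter.1 hp).2.neg_one_pow
  rw [hs, ← Finset.sum_filter_add_sum_filter_not T fun p => ∃ x, isX p.1 x]
  have z : ∑ p ∈ T.filter (fun p => ∃ x, isX p.1 x),
      (-1 : ℤ) ^ (Multiset.card (p.1 + p.2)) = 0 := by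
    refine Finset.sum_involution (fun p _ => (invF p.1, p.2)) ?_ ?_ ?_ ?_
    · rintro ⟨b, g⟩ hp
      obtain ⟨-, x, hx⟩ := Finset.mem_filter.1 hp
      simp only at hx
      simp [invF_eq hx, pow_add, sign_stepF hx]
    · rintro ⟨b, g⟩ hp _ heq
      obtain ⟨-, x, hx⟩ := Finset.mem_filter.1 hp
      simp only at hx
      have h1 : invF b = b := congrArg Prod.fst heq
      have := sign_stepF hx
      rw [← invF_eq hx, h1] at this
      have h0 : (-1 : ℤ) ^ b.card ≠ 0 := by simp
      omega
    · rintro ⟨b, g⟩ hp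
      obtain ⟨hp, x, hx⟩ := Finset.mem_filter.1 hp
      obtain ⟨h1, h2, h3, h4⟩ := (hm _).1 hp
      simp only at hx h1 h2 h3 h4
      have hx0 := isX_pos h1 hx
      refine Finset.mem_filter.2 ⟨(hm _).2 ?_, x, ?_⟩
      · rw [invF_eq hx]
        exact ⟨pos_stepF hx0 h1, h2, by simpa [sum_stepF hx] using h3, h4⟩
      · simp only [invF_eq hx]
        exact isX_stepF hx0 hx
    · rintro ⟨b, g⟩ hp
      obtain ⟨hp, x, hx⟩ := Finset.mem_filter.1 hp
      obtain ⟨h1, h2, h3, h4⟩ := (hm _).1 hp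
      simp only at hx h1 h2 h3 h4
      have hx0 := isX_pos h1 hx
      simp only [invF_eq hx, invF_eq (isX_stepF hx0 hx), stepF_stepF hx0 hx]
  rw [z, zero_add, eQ, Finset.sum_congr rfl (g := fun _ => (-1:ℤ)^n)]
  · simp [mul_comm]
  · rintro ⟨b, g⟩ hp
    obtain ⟨hp, hx⟩ := Finset.mem_filter.1 hp
    obtain ⟨h1, h2, h3, h4⟩ := (hm _).1 hp
    simp only at hx h1 h2 h3 h4
    simp only [Multiset.card_add, pow_add, odd_card _ h4, odd_card _ (no_isX hx).1]
    rw [← pow_add, h3]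
end
end

section
/- For every nonnegative integer n, G_0(n) = (G(n) + H(n))/2, where G_0(n) counts the partitions counted by G(n) having an even number of blue even parts. -/
noncomputable section

def PP (d : ℕ) (m : Multiset ℕ) : Prop := 1 ≤ m.count (2 * d) ∨ 2 ≤ m.count d

def TopIdx (d : ℕ) (m : Multiset ℕ) : Prop :=
  PP d m ∧ ∀ e, d < e → m.count (2 * e) = 0 ∧ m.count e ≤ 1

lemma isTop_unique {d e : ℕ} {m : Multiset ℕ} (h : TopIdx d m) (h' : TopIdx e m) : d = e := by
  rcases lt_trichotomy d e with hl | hl | hl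
  · have := h.2 e hl
    have := h'.1
    unfold PP at this
    omega
  · exact hl
  · have := h'.2 d hl
    have := h.1
    unfold PP at this
    omega

lemma exists_isTop {m : Multiset ℕ} (h : ∃ d, PP d m) : ∃ d, TopIdx d m := by
  classical
  have hle : ∀ d, PP d m → d ≤ m.sum := by
    intro d hd
    rcases hd with hd | hd
    · have := Multiset.le_sum_of_mem (Multiset.one_le_count_iff_mem.1 hd)
      omega
    · exact Multiset.le_sum_of_mem (Multiset.one_le_count_iff_mem.1 (by omega))
  obtain ⟨d, hd⟩ := h
  refine ⟨Nat.findGreatest (fun d => PP d m) m.sum, ?_, ?_⟩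
  · exact Nat.findGreatest_spec (P := fun d => PP d m) (hle d hd) hd
  · intro e he
    have : ¬ PP e m := by
      intro hP
      exact Nat.findGreatest_is_greatest he (hle e hP) hP
    unfold PP at this
    omega

def toggle (d : ℕ) (m : Multiset ℕ) : Multiset ℕ :=
  if 2 * d ∈ m then d ::ₘ d ::ₘ m.erase (2 * d) else (2 * d) ::ₘ (m.erase d).erase d

lemma top_cases {d : ℕ} {m : Multiset ℕ} (hd : 0 < d) (h : TopIdx d m) :
    ∃ s : Multiset ℕ, 2 * d ∉ s ∧ TopIdx d (toggle d m) ∧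
      ((m = (2 * d) ::ₘ s ∧ toggle d m = d ::ₘ d ::ₘ s) ∨
        (m = d ::ₘ d ::ₘ s ∧ toggle d m = (2 * d) ::ₘ s)) := by
  by_cases hm : 2 * d ∈ m
  · obtain ⟨s, rfl⟩ := Multiset.exists_cons_of_mem hm
    have ht : toggle d ((2 * d) ::ₘ s) = d ::ₘ d ::ₘ s := by simp [toggle]
    have h2 := h.2
    simp only [Multiset.count_cons] at h2
    refine ⟨s, ?_, ?_, Or.inl ⟨rfl, ht⟩⟩
    · have := (h2 (2 * d) (by omega)).2
      simp at this
      exact this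
    · rw [ht]
      refine ⟨Or.inr (by simp), ?_⟩
      intro e he
      have := h2 e he
      have h3 : e ≠ d := by omega
      have h4 : 2 * e ≠ d := by omega
      simp only [Multiset.count_cons, if_neg h3, if_neg h4]
      omega
  · have hc : 2 ≤ m.count d := by
      rcases h.1 with h1 | h1
      · exact absurd (Multiset.one_le_count_iff_mem.1 h1) hm
      · exact h1
    obtain ⟨t, rfl⟩ := Multiset.exists_cons_of_mem (Multiset.one_le_count_iff_mem.1 (by omega : 1 ≤ m.count d))
    rw [Multiset.count_cons_self] at hc
    obtain ⟨s, rfl⟩ := Multiset.exists_cons_of_mem (Multiset.one_le_count_iff_mem.1 (by omega : 1 ≤ t.count d))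
    have ht : toggle d (d ::ₘ d ::ₘ s) = (2 * d) ::ₘ s := by
      rw [toggle, if_neg hm]; simp
    have hs : 2 * d ∉ s := fun hh => hm (by simp [hh])
    have h2 := h.2
    simp only [Multiset.count_cons] at h2
    refine ⟨s, hs, ?_, Or.inr ⟨rfl, ht⟩⟩
    rw [ht]
    refine ⟨Or.inl (by simp), ?_⟩
    intro e he
    have := h2 e he
    have h3 : 2 * e ≠ 2 * d := by omega
    simp only [Multiset.count_cons, if_neg h3]
    refine ⟨by omega, ?_⟩
    split_ifs with h5
    · subst h5
      rw [Multiset.count_eq_zero_of_notMem hs]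
    · omega

lemma toggle_toggle {d : ℕ} {m : Multiset ℕ} (hd : 0 < d) (h : TopIdx d m) :
    toggle d (toggle d m) = m := by
  obtain ⟨s, hs, ht, ⟨h1, h2⟩ | ⟨h1, h2⟩⟩ := top_cases hd h
  · rw [h2, h1, toggle, if_neg]
    · simp
    · simp [hs]; omega
  · rw [h2, h1, toggle, if_pos]
    · simp
    · simp

open Classical in
def phi (m : Multiset ℕ) : Multiset ℕ :=
  if h : ∃ d, TopIdx d m then toggle h.choose m else m

lemma phi_eq {d : ℕ} {m : Multiset ℕ} (h : TopIdx d m) : phi m = toggle d m := by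
  have hh : ∃ d, TopIdx d m := ⟨d, h⟩
  rw [phi, dif_pos hh, isTop_unique hh.choose_spec h]

lemma top_pos {d : ℕ} {m : Multiset ℕ} (hm : ∀ x ∈ m, 0 < x) (h : TopIdx d m) : 0 < d := by
  rcases h.1 with h1 | h1
  · have := hm _ (Multiset.one_le_count_iff_mem.1 h1); omega
  · exact hm _ (Multiset.one_le_count_iff_mem.1 (by omega))

lemma phi_spec {m : Multiset ℕ} (hm : ∀ x ∈ m, 0 < x) (h : ∃ d, PP d m) :
    (∀ x ∈ phi m, 0 < x) ∧ (∃ d, PP d (phi m)) ∧ (phi m).sum = m.sum ∧ phi (phi m) = m ∧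
      (-1 : ℤ) ^ evenParts m + (-1) ^ evenParts (phi m) = 0 := by
  obtain ⟨d, hd⟩ := exists_isTop h
  have hp := top_pos hm hd
  have h3 := toggle_toggle hp hd
  rw [phi_eq hd]
  obtain ⟨s, hs, ht, hc⟩ := top_cases hp hd
  refine ⟨?_, ⟨d, ht.1⟩, ?_, ?_, ?_⟩
  · rcases hc with ⟨h1, h2⟩ | ⟨h1, h2⟩
    · rw [h2]; subst h1; simp at hm ⊢; exact ⟨hp, hm.2⟩
    · rw [h2]; subst h1; simp at hm ⊢; exact ⟨hp, hm.2⟩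
  · rcases hc with ⟨h1, h2⟩ | ⟨h1, h2⟩
    · rw [h2, h1]; simp; omega
    · rw [h2, h1]; simp; omega
  · rw [phi_eq ht, h3]
  · rcases hc with ⟨h1, h2⟩ | ⟨h1, h2⟩ <;> rw [h2, h1] <;>
    · by_cases he : Even d <;> simp [evenParts, he, pow_succ]

lemma GSet_finite (n : ℕ) : (GSet n).Finite := by
  have hA : {m : Multiset ℕ | (∀ x ∈ m, 0 < x) ∧ m.sum ≤ n}.Finite := by
    have : {m : Multiset ℕ | (∀ x ∈ m, 0 < x) ∧ m.sum ≤ n} ⊆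
        ⋃ k ∈ Set.Iic n, Set.range (fun p : Nat.Partition k => p.parts) := by
      rintro m ⟨h1, h2⟩
      simp only [Set.mem_iUnion]
      exact ⟨m.sum, h2, ⟨m, fun {i} hi => h1 i hi, rfl⟩, rfl⟩
    exact (Set.Finite.biUnion (Set.finite_Iic n) (fun k _ => Set.finite_range _)).subset this
  refine (hA.prod hA).subset ?_
  rintro ⟨a, b⟩ ⟨h1, h2, h3, h4⟩
  dsimp at *
  exact ⟨⟨h1, by dsimp; omega⟩, ⟨h2, by dsimp; omega⟩⟩

lemma not_PP_iff {m : Multiset ℕ} :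
    (¬ ∃ d, PP d m) ↔ (∀ x ∈ m, Odd x) ∧ m.Nodup := by
  rw [Multiset.nodup_iff_count_le_one]
  unfold PP
  constructor
  · intro h
    push Not at h
    refine ⟨fun x hx => ?_, fun x => by have := h x; omega⟩
    by_contra ho
    obtain ⟨k, hk⟩ := even_iff_two_dvd.1 (Nat.not_odd_iff_even.1 ho)
    have := (h k).1
    have := Multiset.one_le_count_iff_mem.2 hx
    rw [hk] at this
    omega
  · rintro ⟨h1, h2⟩ ⟨d, hd | hd⟩
    · have := h1 _ (Multiset.one_le_count_iff_mem.1 hd)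
      exact absurd this (by simp)
    · have := h2 d; omega

lemma filter_pair {a b : Multiset ℕ} (ha : ∀ x ∈ a, Odd x) (hb : ∀ x ∈ b, Even x) :
    (a + b).filter (fun x => Odd x) = a ∧ (a + b).filter (fun x => ¬ Odd x) = b := by
  constructor
  · rw [Multiset.filter_add, Multiset.filter_eq_self.2 ha, Multiset.filter_eq_nil.2, add_zero]
    intro x hx; exact Nat.not_odd_iff_even.2 (hb x hx)
  · rw [Multiset.filter_add, Multiset.filter_eq_nil.2, Multiset.filter_eq_self.2, zero_add]
    · intro x hx; exact Nat.not_odd_iff_even.2 (hb x hx)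
    · intro x hx; exact not_not.2 (ha x hx)

lemma R_eq_H (n : ℕ) : Rcount n = Hcount n := by
  unfold Rcount Hcount
  refine Set.ncard_congr (fun p _ => p.1 + p.2) ?_ ?_ ?_
  · rintro ⟨a, b⟩ ⟨⟨h1, h2, h3, h4⟩, h5, h6⟩
    dsimp at *
    refine ⟨?_, by simpa using h3, ?_⟩
    · intro x hx
      rcases Multiset.mem_add.1 hx with hx | hx
      · exact h1 x hx
      · exact h2 x hx
    · rw [(filter_pair h5 h4).1]; exact h6
  · rintro ⟨a, b⟩ ⟨a', b'⟩ ⟨⟨_, _, _, h4⟩, h5, _⟩ ⟨⟨_, _, _, h4'⟩, h5', _⟩ h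
    dsimp at *
    have e1 := filter_pair h5 h4
    have e2 := filter_pair h5' h4'
    rw [h] at e1
    rw [Prod.mk.injEq]
    exact ⟨e1.1.symm.trans e2.1, e1.2.symm.trans e2.2⟩
  · rintro m ⟨h1, h2, h3⟩
    refine ⟨(m.filter (fun x => Odd x), m.filter (fun x => ¬ Odd x)), ⟨⟨?_, ?_, ?_, ?_⟩, ?_, h3⟩, ?_⟩
    · intro x hx; exact h1 x (Multiset.mem_filter.1 hx).1
    · intro x hx; exact h1 x (Multiset.mem_filter.1 hx).1
    · rw [← Multiset.sum_add, Multiset.filter_add_not, h2]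
    · intro x hx; exact Nat.not_odd_iff_even.1 (Multiset.mem_filter.1 hx).2
    · intro x hx; exact (Multiset.mem_filter.1 hx).2
    · exact Multiset.filter_add_not _ _

lemma key (n : ℕ) : 2 * (G0 n : ℤ) = Gcount n + Rcount n := by
  classical
  have hf := GSet_finite n
  set S := hf.toFinset with hS
  have hG : Gcount n = S.card := Set.ncard_eq_toFinset_card _ hf
  have hG0 : G0 n = (S.filter (fun p => Even (evenParts p.1))).card := by
    unfold G0
    rw [← Set.ncard_coe_finset]
    congr 1
    ext p
    simp [hS]
  have hR : Rcount n = (S.filter (fun p => ¬ ∃ d, PP d p.1)).card := by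
    unfold Rcount
    rw [← Set.ncard_coe_finset]
    congr 1
    ext p
    simp only [Finset.coe_filter, Set.mem_ofPred_eq, not_PP_iff, RSet, hS, Set.Finite.mem_toFinset]
  have h1 : ∑ p ∈ S.filter (fun p => ∃ d, PP d p.1), (-1 : ℤ) ^ evenParts p.1 = 0 := by
    have hspec : ∀ p ∈ S.filter (fun p => ∃ d, PP d p.1), p ∈ GSet n ∧ ∃ d, PP d p.1 := by
      intro p hp
      simpa [hS] using hp
    refine Finset.sum_involution (fun p _ => (phi p.1, p.2)) ?_ ?_ ?_ ?_
    · intro p hp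
      obtain ⟨hg, hP⟩ := hspec p hp
      exact (phi_spec hg.1 hP).2.2.2.2
    · intro p hp hne heq
      obtain ⟨hg, hP⟩ := hspec p hp
      have := (phi_spec hg.1 hP).2.2.2.2
      have h2 : phi p.1 = p.1 := congrArg Prod.fst heq
      rw [h2] at this
      omega
    · intro p hp
      obtain ⟨hg, hP⟩ := hspec p hp
      obtain ⟨q1, q2, q3, q4, q5⟩ := phi_spec hg.1 hP
      rw [Finset.mem_filter, hS, Set.Finite.mem_toFinset]
      refine ⟨⟨q1, hg.2.1, ?_, hg.2.2.2⟩, q2⟩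
      dsimp only
      rw [q3]; exact hg.2.2.1
    · intro p hp
      obtain ⟨hg, hP⟩ := hspec p hp
      have := (phi_spec hg.1 hP).2.2.2.1
      exact Prod.ext this rfl
  have h2 : ∑ p ∈ S.filter (fun p => ¬ ∃ d, PP d p.1), (-1 : ℤ) ^ evenParts p.1 = Rcount n := by
    rw [hR, Finset.card_eq_sum_ones, Nat.cast_sum]
    refine Finset.sum_congr rfl ?_
    intro p hp
    have h := (not_PP_iff.1 (Finset.mem_filter.1 hp).2).1
    have : evenParts p.1 = 0 := by
      rw [evenParts, Multiset.card_eq_zero, Multiset.filter_eq_nil]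
      intro x hx
      exact Nat.not_even_iff_odd.2 (h x hx)
    simp [this]
  have h3 := Finset.sum_filter_add_sum_filter_not S (fun p => ∃ d, PP d p.1)
    (fun p => (-1 : ℤ) ^ evenParts p.1)
  rw [h1, h2, zero_add] at h3
  rw [h3, hG, hG0, Finset.card_eq_sum_ones S, Finset.card_filter]
  push_cast
  rw [← Finset.sum_add_distrib, Finset.mul_sum]
  refine Finset.sum_congr rfl ?_
  intro p _
  by_cases he : Even (evenParts p.1)
  · simp [he]
  · simp [he, (Nat.not_even_iff_odd.1 he).neg_one_pow]

/-- `G₀(n) = (G(n) + H(n)) / 2`. -/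
theorem G0_eq (n : ℕ) : (G0 n : ℚ) = ((Gcount n : ℚ) + (Hcount n : ℚ)) / 2 := by
  have h := key n
  rw [R_eq_H] at h
  have h' : 2 * (G0 n : ℚ) = Gcount n + Hcount n := by exact_mod_cast h
  linarith
end
end
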